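/- Let f : ℝ → ℝ be odd and locally Lipschitz, let k ∈ ℝ, and let m > 0. Suppose w is a C⁴ solution of w''''(s) + k·w''(s) + f(w(s)) = 0 on [0, m] with w(0) = w''(0) = 0 and w'(m) = w'''(m) = 0 (i.e. m is a point of symmetry). Then there exists a C⁴ solution W : ℝ → ℝ of the same equation which is periodic with period 4m and satisfies W(s) = w(s) for all s ∈ [0, m]; W is obtained by oddly reflecting w about s = 0 and evenly reflecting about s = m. -/

import Mathlib

open Set

/-- A function which is odd about `0` and even about `m` is `4 * m`-periodic. -/
lemma periodic_of_odd_of_reflect {m : ℝ} {F : ℝ → ℝ} (h0 : ∀ s, F (-s) = -F s)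
    (hm : ∀ s, F (2 * m - s) = F s) : Function.Periodic F (4 * m) := by
  intro s
  have h1 : F (s + 4 * m) = F (-(s + 2 * m)) := by
    rw [← hm (s + 4 * m)]; ring_nf
  have h2 : F (s + 2 * m) = F (-s) := by
    rw [← hm (-s)]; ring_nf
  rw [h1, h0, h2, h0, neg_neg]

/-- A function which is odd about `0`, even about `m` and vanishes on `[0, m]` vanishes. -/
lemma eq_zero_of_odd_of_reflect {m : ℝ} {F : ℝ → ℝ} (hpos : 0 < m) (h0 : ∀ s, F (-s) = -F s)
    (hm : ∀ s, F (2 * m - s) = F s) (hF : ∀ s ∈ Icc 0 m, F s = 0) (s : ℝ) : F s = 0 := by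
  have hsymm : ∀ t ∈ Icc (-m) m, F t = 0 := by
    intro t ht
    rcases le_total 0 t with h | h
    · exact hF t ⟨h, ht.2⟩
    · have := hF (-t) ⟨by linarith, by linarith [ht.1]⟩
      rwa [h0, neg_eq_zero] at this
  obtain ⟨t, ht, hst⟩ :=
    (periodic_of_odd_of_reflect h0 hm).exists_mem_Ico (by positivity) s (-m)
  rw [hst]
  rcases le_total t m with h | h
  · exact hsymm t ⟨ht.1, h⟩
  · rw [← hm t]
    exact hsymm _ ⟨by linarith [ht.2], by linarith⟩

/-- Symmetry of a derivative under `s ↦ c - s` passes to the primitive, up to sign, once it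
holds at one point. -/
lemma reflect_of_hasDerivAt {F F' : ℝ → ℝ} {c e a : ℝ} (hF : ∀ s, HasDerivAt F (F' s) s)
    (hF' : ∀ s, F' (c - s) = -e * F' s) (ha : F (c - a) = e * F a) (s : ℝ) :
    F (c - s) = e * F s := by
  have hd : ∀ t, HasDerivAt (fun t => F (c - t) - e * F t) 0 t := by
    intro t
    have h := ((hF (c - t)).comp_const_sub c t).sub ((hF t).const_mul e)
    have hz : -F' (c - t) - e * F' t = 0 := by rw [hF']; ring
    rwa [hz] at h
  have := is_const_of_deriv_eq_zero (fun t => (hd t).differentiableAt) (fun t => (hd t).deriv) s a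
  simp only [ha, sub_self] at this
  linarith

/-- A function whose derivative within `[0, m]` agrees with the derivative of `F` agrees with `F`
on `[0, m]` once it does so at one point. -/
lemma eqOn_of_hasDerivAt_of_derivWithin {F F' g : ℝ → ℝ} {m a : ℝ}
    (hF : ∀ s, HasDerivAt F (F' s) s)
    (hg : DifferentiableOn ℝ g (Icc 0 m)) (hg' : ∀ s ∈ Icc 0 m, F' s = derivWithin g (Icc 0 m) s)
    (ha : a ∈ Icc 0 m) (hFa : F a = g a) : ∀ s ∈ Icc 0 m, F s = g s := by
  intro s hs
  have hd : ∀ t ∈ Icc 0 m, HasDerivWithinAt (fun t => F t - g t) 0 (Icc 0 m) t := by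
    intro t ht
    have h := (hF t).hasDerivWithinAt.sub (hg t ht).hasDerivWithinAt
    rwa [hg' t ht, sub_self] at h
  have := (convex_Icc 0 m).norm_image_sub_le_of_norm_hasDerivWithin_le (C := 0) hd
    (fun _ _ => by simp) ha hs
  rw [zero_mul, norm_le_zero_iff] at this
  linarith

/-- Every continuous function on `[0, m]` vanishing at `0` extends continuously to the line, oddly
about `0` and evenly about `m`. -/
lemma exists_continuous_odd_reflect_extension {m : ℝ} {h : ℝ → ℝ} (hm : 0 < m)
    (hc : ContinuousOn h (Icc 0 m)) (h0 : h 0 = 0) :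
    ∃ H : ℝ → ℝ, Continuous H ∧ (∀ s ∈ Icc 0 m, H s = h s) ∧ (∀ s, H (-s) = -H s) ∧
      ∀ s, H (2 * m - s) = H s := by
  have hpi := Real.pi_pos
  -- the triangle wave of period `4 * m`
  set ψ : ℝ → ℝ := fun s => 2 * m / Real.pi * Real.arcsin (Real.sin (Real.pi / (2 * m) * s))
    with hψ
  have hψc : Continuous ψ := by fun_prop
  have hψneg (s : ℝ) : ψ (-s) = -ψ s := by simp [hψ]
  have hψrefl (s : ℝ) : ψ (2 * m - s) = ψ s := by
    have : Real.pi / (2 * m) * (2 * m - s) = Real.pi - Real.pi / (2 * m) * s := by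
      field_simp
    simp only [hψ, this, Real.sin_pi_sub]
  have hψid : ∀ s ∈ Icc 0 m, ψ s = s := by
    intro s hs
    have hle : Real.pi / (2 * m) * s ≤ Real.pi / 2 := by
      calc Real.pi / (2 * m) * s ≤ Real.pi / (2 * m) * m := by gcongr; exact hs.2
        _ = Real.pi / 2 := by field_simp
    have hge : 0 ≤ Real.pi / (2 * m) * s := mul_nonneg (by positivity) hs.1
    simp only [hψ]
    rw [Real.arcsin_sin (by linarith) hle]
    field_simp
  have hψle (s : ℝ) : ψ s ≤ m := by
    calc ψ s ≤ 2 * m / Real.pi * (Real.pi / 2) := by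
          simp only [hψ]; gcongr; exact Real.arcsin_le_pi_div_two _
      _ = m := by field_simp
  have hmem (s : ℝ) : max (ψ s) 0 ∈ Icc 0 m := ⟨le_max_right _ _, max_le (hψle s) hm.le⟩
  have hcont : Continuous fun s => h (max (ψ s) 0) :=
    hc.comp_continuous (hψc.max continuous_const) hmem
  refine ⟨fun s => h (max (ψ s) 0) - h (max (ψ (-s)) 0), hcont.sub (hcont.comp continuous_neg),
    ?_, ?_, ?_⟩
  · intro s hs
    simp [hψneg, hψid s hs, hs.1, h0]
  · intro s
    simp
  · intro s
    simp only [hψneg, hψrefl]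

/-- Primitives of a continuous real function, normalised to vanish at a given point. -/
lemma exists_primitive {g : ℝ → ℝ} (hg : Continuous g) (a : ℝ) :
    ∃ G : ℝ → ℝ, (∀ s, HasDerivAt G (g s) s) ∧ G a = 0 :=
  ⟨fun s => ∫ t in a..s, g t, fun s => hg.integral_hasStrictDerivAt a s |>.hasDerivAt, by simp⟩

lemma contDiff_succ_of_hasDerivAt {n : ℕ} {F F' : ℝ → ℝ} (hF : ∀ s, HasDerivAt F (F' s) s)
    (hF' : ContDiff ℝ n F') : ContDiff ℝ (n + 1 : ℕ) F := by
  have hd : deriv F = F' := funext fun s => (hF s).deriv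
  push_cast
  rw [contDiff_succ_iff_deriv]
  exact ⟨fun s => (hF s).differentiableAt, by simp, by rwa [hd]⟩

/-- **Reflection/periodicity construction** (Section 4). Let `f` be odd and locally
Lipschitz, `k ∈ ℝ`, `m > 0`. If `w` is a C⁴ solution of `w'''' + k w'' + f(w) = 0` on
`[0, m]` with `w(0) = w''(0) = 0` and `w'(m) = w'''(m) = 0` (a point of symmetry), then
there is a C⁴ solution `W : ℝ → ℝ` of the same equation, periodic with period `4m`,
agreeing with `w` on `[0, m]`, obtained by odd reflection about `s = 0` and even
reflection about `s = m`. -/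
theorem periodic_extension_from_symmetry (f : ℝ → ℝ) (k m : ℝ) (w : ℝ → ℝ)
    (hodd : ∀ t : ℝ, f (-t) = -f t) (hlip : LocallyLipschitz f) (hm : 0 < m)
    (hreg : ContDiffOn ℝ 4 w (Set.Icc 0 m))
    (hode : ∀ s ∈ Set.Icc 0 m,
      iteratedDerivWithin 4 w (Set.Icc 0 m) s + k * iteratedDerivWithin 2 w (Set.Icc 0 m) s +
        f (w s) = 0)
    (hw0 : w 0 = 0) (hw''0 : iteratedDerivWithin 2 w (Set.Icc 0 m) 0 = 0)
    (hw'm : iteratedDerivWithin 1 w (Set.Icc 0 m) m = 0)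
    (hw'''m : iteratedDerivWithin 3 w (Set.Icc 0 m) m = 0) :
    ∃ W : ℝ → ℝ,
      ContDiff ℝ 4 W ∧
      (∀ s : ℝ, iteratedDeriv 4 W s + k * iteratedDeriv 2 W s + f (W s) = 0) ∧
      Function.Periodic W (4 * m) ∧
      (∀ s ∈ Set.Icc 0 m, W s = w s) ∧
      (∀ s : ℝ, W (-s) = -W s) ∧
      (∀ s : ℝ, W (2 * m - s) = W s) := by
  set I : Set ℝ := Icc 0 m with hI
  have h0I : (0 : ℝ) ∈ I := ⟨le_rfl, hm.le⟩
  have hmI : m ∈ I := ⟨hm.le, le_rfl⟩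
  have hu : UniqueDiffOn ℝ I := uniqueDiffOn_Icc hm
  have hf0 : f 0 = 0 := by
    have := hodd 0
    rw [neg_zero] at this
    linarith
  have hg40 : iteratedDerivWithin 4 w I 0 = 0 := by
    have := hode 0 h0I
    rw [hw''0, hw0, hf0] at this
    linarith
  have hdiff (j : ℕ) (hj : j < 4) : DifferentiableOn ℝ (iteratedDerivWithin j w I) I :=
    hreg.differentiableOn_iteratedDerivWithin (by exact_mod_cast hj) hu
  -- extend the fourth derivative by reflection, then integrate four times
  obtain ⟨H, hHc, hHw, hHodd, hHrefl⟩ := exists_continuous_odd_reflect_extension hm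
    (hreg.continuousOn_iteratedDerivWithin (m := 4) (by norm_num) hu) hg40
  obtain ⟨W₃, hW₃, hW₃m⟩ := exists_primitive hHc m
  have hc₃ : ContDiff ℝ (1 : ℕ) W₃ :=
    contDiff_succ_of_hasDerivAt hW₃ (by simpa using hHc)
  obtain ⟨W₂, hW₂, hW₂0⟩ := exists_primitive hc₃.continuous 0
  have hc₂ : ContDiff ℝ (2 : ℕ) W₂ := contDiff_succ_of_hasDerivAt hW₂ hc₃
  obtain ⟨W₁, hW₁, hW₁m⟩ := exists_primitive hc₂.continuous m
  have hc₁ : ContDiff ℝ (3 : ℕ) W₁ := contDiff_succ_of_hasDerivAt hW₁ hc₂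
  obtain ⟨W, hW, hW0⟩ := exists_primitive hc₁.continuous 0
  have hc : ContDiff ℝ (4 : ℕ) W := contDiff_succ_of_hasDerivAt hW hc₁
  -- the primitives agree with the derivatives of `w` on `[0, m]`
  have he₃ : ∀ s ∈ I, W₃ s = iteratedDerivWithin 3 w I s :=
    eqOn_of_hasDerivAt_of_derivWithin hW₃ (hdiff 3 (by norm_num))
      (fun s hs => by rw [hHw s hs, iteratedDerivWithin_succ]) hmI (by rw [hW₃m, hw'''m])
  have he₂ : ∀ s ∈ I, W₂ s = iteratedDerivWithin 2 w I s :=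
    eqOn_of_hasDerivAt_of_derivWithin hW₂ (hdiff 2 (by norm_num))
      (fun s hs => by rw [he₃ s hs, iteratedDerivWithin_succ]) h0I (by rw [hW₂0, hw''0])
  have he₁ : ∀ s ∈ I, W₁ s = iteratedDerivWithin 1 w I s :=
    eqOn_of_hasDerivAt_of_derivWithin hW₁ (hdiff 1 (by norm_num))
      (fun s hs => by rw [he₂ s hs, iteratedDerivWithin_succ]) hmI (by rw [hW₁m, hw'm])
  have he : ∀ s ∈ I, W s = w s :=
    eqOn_of_hasDerivAt_of_derivWithin hW (hreg.differentiableOn (by norm_num))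
      (fun s hs => by rw [he₁ s hs, iteratedDerivWithin_one]) h0I (by rw [hW0, hw0])
  -- symmetries propagate to primitives
  have even_odd {F G : ℝ → ℝ} (hF : ∀ s, HasDerivAt F (G s) s) (hFm : F m = 0)
      (h0 : ∀ s, G (-s) = -G s) (h1 : ∀ s, G (2 * m - s) = G s) :
      (∀ s, F (-s) = F s) ∧ ∀ s, F (2 * m - s) = -F s := by
    constructor <;> intro s
    · simpa using reflect_of_hasDerivAt (c := 0) (e := 1) (a := 0) hF (by simpa using h0)
        (by simp) s
    · simpa using reflect_of_hasDerivAt (c := 2 * m) (e := -1) (a := m) hF (by simpa using h1)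
        (by rw [show 2 * m - m = m by ring, hFm]; simp) s
  have odd_even {F G : ℝ → ℝ} (hF : ∀ s, HasDerivAt F (G s) s) (hF0 : F 0 = 0)
      (h0 : ∀ s, G (-s) = G s) (h1 : ∀ s, G (2 * m - s) = -G s) :
      (∀ s, F (-s) = -F s) ∧ ∀ s, F (2 * m - s) = F s := by
    constructor <;> intro s
    · simpa using reflect_of_hasDerivAt (c := 0) (e := -1) (a := 0) hF (by simpa using h0)
        (by simp [hF0]) s
    · simpa using reflect_of_hasDerivAt (c := 2 * m) (e := 1) (a := m) hF (by simpa using h1)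
        (by rw [show 2 * m - m = m by ring, one_mul]) s
  have hs₃ := even_odd hW₃ hW₃m hHodd hHrefl
  have hs₂ := odd_even hW₂ hW₂0 hs₃.1 hs₃.2
  have hs₁ := even_odd hW₁ hW₁m hs₂.1 hs₂.2
  have hs := odd_even hW hW0 hs₁.1 hs₁.2
  have hd₂ : iteratedDeriv 2 W = W₂ := by
    rw [iteratedDeriv_succ', iteratedDeriv_one, funext fun s => (hW s).deriv,
      funext fun s => (hW₁ s).deriv]
  have hd₄ : iteratedDeriv 4 W = H := by
    rw [iteratedDeriv_succ, iteratedDeriv_succ, hd₂, funext fun s => (hW₂ s).deriv,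
      funext fun s => (hW₃ s).deriv]
  refine ⟨W, hc, ?_, periodic_of_odd_of_reflect hs.1 hs.2, he, hs.1, hs.2⟩
  rw [hd₂, hd₄]
  refine eq_zero_of_odd_of_reflect hm (fun s => ?_) (fun s => ?_) fun s hsI => ?_
  · rw [hHodd, hs₂.1, hs.1, hodd]; ring
  · rw [hHrefl, hs₂.2, hs.2]
  · rw [hHw s hsI, he₂ s hsI, he s hsI]
    exact hode s hsI
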